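/- For each 0 ≤ n < ℓ and each subset J ⊆ {1, …, d} with |J| = d − n, there exists a monic polynomial Q of degree d − n − m_λ(n) with coefficients in R_a(λ) such that, in the polynomial ring R_a(λ)[X], the image of ∏_{j∈J}(X + t_j) equals (∏_{i=1}^{m_λ(n)} (X + a^{(n)}_i)) · Q. In other words, in R_a(λ)[X] the polynomial ∏_{i=1}^{m_λ(n)}(X + a^{(n)}_i) divides the image of ∏_{j∈J}(X + t_j), with quotient monic of degree d − n − m_λ(n). -/

import Mathlib

open MvPolynomial

noncomputable section

/-- Complete homogeneous symmetric function `h_k` of a list of complex numbers. -/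
def hcomp : ℕ → List ℂ → ℂ
  | 0, _ => 1
  | _ + 1, [] => 0
  | k + 1, x :: l => x * hcomp k (x :: l) + hcomp (k + 1) l
  termination_by k l => (l.length, k)

/-- Elementary symmetric polynomial `e_r` in the variables indexed by `J ⊆ {1,…,d}`. -/
def elemSym (d : ℕ) (J : Finset (Fin d)) (r : ℕ) : MvPolynomial (Fin d) ℂ :=
  ∑ s ∈ J.powersetCard r, ∏ j ∈ s, X j

/-- The tuple `a^{(n)}` : entries `a_1,…,a_{λ_i}` for each row `i = n+1,…,ℓ` (0-indexed rows). -/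
def aTuple (ℓ : ℕ) (lam : ℕ → ℕ) (a : ℕ → ℂ) (n : ℕ) : List ℂ :=
  ((List.range ℓ).drop n).flatMap fun i => (List.range (lam i)).map a

/-- `m_λ(n) = λ_{n+1} + … + λ_ℓ` (0-indexed rows `n,…,ℓ-1`). -/
def mRem (ℓ : ℕ) (lam : ℕ → ℕ) (n : ℕ) : ℕ := ∑ i ∈ Finset.Ico n ℓ, lam i

/-- The deformed Tanisaki generator `g_{n,J,r} = Σ_{k=0}^r (−1)^k e_{r−k}(t_J) h_k(a^{(n)})`. -/
def tanGen (d ℓ : ℕ) (lam : ℕ → ℕ) (a : ℕ → ℂ) (n : ℕ) (J : Finset (Fin d)) (r : ℕ) :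
    MvPolynomial (Fin d) ℂ :=
  ∑ k ∈ Finset.range (r + 1), C ((-1) ^ k * hcomp k (aTuple ℓ lam a n)) * elemSym d J (r - k)

/-- The deformed Tanisaki ideal `⟨𝒞^a_λ⟩`. -/
def tanIdeal (d ℓ : ℕ) (lam : ℕ → ℕ) (a : ℕ → ℂ) : Ideal (MvPolynomial (Fin d) ℂ) :=
  Ideal.span {g | ∃ n J r, n < ℓ ∧ J.card = d - n ∧
    d - n - mRem ℓ lam n < r ∧ r ≤ d - n ∧ g = tanGen d ℓ lam a n J r}

/-- `lam 0, lam 1, …, lam (ℓ-1)` is a partition of `d` with `ℓ` positive parts. -/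
def IsPartitionOf (d ℓ : ℕ) (lam : ℕ → ℕ) : Prop :=
  0 < ℓ ∧ (∀ i j, i ≤ j → lam j ≤ lam i) ∧ (∀ i < ℓ, 0 < lam i) ∧
    (∀ i, ℓ ≤ i → lam i = 0) ∧ ∑ i ∈ Finset.range ℓ, lam i = d

/-- `λ^t_i = #{rows j with λ_j ≥ i}` (here `i ≥ 1`). -/
def lamT (ℓ : ℕ) (lam : ℕ → ℕ) (i : ℕ) : ℕ :=
  ((Finset.range ℓ).filter fun j => i ≤ lam j).card

/-- The deformed Tanisaki–Garsia–Procesi algebra `R_a(λ)`. -/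
abbrev TGPAlg (d ℓ : ℕ) (lam : ℕ → ℕ) (a : ℕ → ℂ) :=
  MvPolynomial (Fin d) ℂ ⧸ tanIdeal d ℓ lam a


theorem one_add_mul_hcomp {S : Type*} [CommRing S] [Algebra ℂ S] (x : ℂ) (l : List ℂ) :
    (1 + PowerSeries.C (algebraMap ℂ S x) * PowerSeries.X) *
      PowerSeries.mk (fun k => algebraMap ℂ S ((-1) ^ k * hcomp k (x :: l))) =
      PowerSeries.mk (fun k => algebraMap ℂ S ((-1) ^ k * hcomp k l)) := by
  ext k
  rw [add_mul, one_mul, mul_assoc, map_add, PowerSeries.coeff_C_mul]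
  cases k with
  | zero => simp [hcomp]
  | succ k =>
    rw [PowerSeries.coeff_succ_X_mul]
    simp only [PowerSeries.coeff_mk]
    rw [hcomp, ← map_mul, ← map_add]
    congr 1
    ring

/-- `∏ (1 + a z)` -/
def revProd (S : Type*) [CommRing S] [Algebra ℂ S] (l : List ℂ) : Polynomial S :=
  (l.map fun c => 1 + Polynomial.C (algebraMap ℂ S c) * Polynomial.X).prod

def hSer (S : Type*) [CommRing S] [Algebra ℂ S] (l : List ℂ) : PowerSeries S :=
  PowerSeries.mk (fun k => algebraMap ℂ S ((-1) ^ k * hcomp k l))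

theorem revProd_mul_hSer {S : Type*} [CommRing S] [Algebra ℂ S] (l : List ℂ) :
    (revProd S l : PowerSeries S) * hSer S l = 1 := by
  induction l with
  | nil =>
    ext k
    cases k <;> simp [revProd, hSer, hcomp, PowerSeries.coeff_one]
  | cons x l ih =>
    have h := one_add_mul_hcomp (S := S) x l
    rw [← hSer, ← hSer] at h
    have : (revProd S (x :: l) : PowerSeries S) =
        (revProd S l : PowerSeries S) *
          (1 + PowerSeries.C (algebraMap ℂ S x) * PowerSeries.X) := by
      rw [mul_comm]
      simp [revProd]
    rw [this, mul_assoc, h, ih]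

theorem natDegree_lin {S : Type*} [CommRing S] (c : S) :
    (1 + Polynomial.C c * Polynomial.X).natDegree ≤ 1 := by
  compute_degree

theorem natDegree_lin' {S : Type*} [CommRing S] (c : S) :
    (Polynomial.X + Polynomial.C c).natDegree ≤ 1 := by
  compute_degree

theorem reflect_lin {S : Type*} [CommRing S] (c : S) :
    Polynomial.reflect 1 (1 + Polynomial.C c * Polynomial.X) =
      Polynomial.X + Polynomial.C c := by
  rw [Polynomial.reflect_add, Polynomial.reflect_one, Polynomial.reflect_C_mul]
  have := Polynomial.reflect_monomial (R := S) 1 1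
  simp only [pow_one] at this
  rw [this]
  have h1 : (Polynomial.revAt 1) 1 = 0 := Polynomial.revAt_le le_rfl
  simp [h1]

theorem revProd_natDegree {S : Type*} [CommRing S] [Algebra ℂ S] (l : List ℂ) :
    (revProd S l).natDegree ≤ l.length := by
  induction l with
  | nil => simp [revProd]
  | cons x l ih =>
    have : revProd S (x :: l) = (1 + Polynomial.C (algebraMap ℂ S x) * Polynomial.X) *
      revProd S l := by simp [revProd]
    rw [this]
    refine Polynomial.natDegree_mul_le.trans ?_
    have := natDegree_lin (algebraMap ℂ S x)
    simp only [List.length_cons]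
    omega

theorem reflect_revProd {S : Type*} [CommRing S] [Algebra ℂ S] (l : List ℂ) :
    Polynomial.reflect l.length (revProd S l) =
      (l.map fun c => Polynomial.X + Polynomial.C (algebraMap ℂ S c)).prod := by
  induction l with
  | nil => simp [revProd]
  | cons x l ih =>
    have : revProd S (x :: l) = (1 + Polynomial.C (algebraMap ℂ S x) * Polynomial.X) *
      revProd S l := by simp [revProd]
    rw [this, List.length_cons, add_comm l.length 1,
      Polynomial.reflect_mul _ _ (natDegree_lin _) (revProd_natDegree l), ih, reflect_lin]
    simp

theorem coeff_eq_zero_all {S : Type*} [CommRing S] (E A : Polynomial S) (H : PowerSeries S)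
    (hAH : (A : PowerSeries S) * H = 1) (hA0 : A.coeff 0 = 1) (N m : ℕ)
    (hE : E.natDegree ≤ N) (hA : A.natDegree ≤ m) (hm : m ≤ N)
    (h : ∀ r, N - m < r → r ≤ N → PowerSeries.coeff r ((E : PowerSeries S) * H) = 0) :
    ∀ r, N - m < r → PowerSeries.coeff r ((E : PowerSeries S) * H) = 0 := by
  intro r
  induction r using Nat.strong_induction_on with
  | _ r ih =>
    intro hr
    by_cases hrN : r ≤ N
    · exact h r hr hrN
    have key : (A : PowerSeries S) * ((E : PowerSeries S) * H) = E := by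
      rw [mul_left_comm, hAH, mul_one]
    have h2 := congrArg (PowerSeries.coeff r) key
    rw [PowerSeries.coeff_mul, Polynomial.coeff_coe,
      Polynomial.coeff_eq_zero_of_natDegree_lt (by omega : E.natDegree < r),
      Finset.sum_eq_single (0, r)] at h2
    · simpa [hA0] using h2
    · rintro ⟨i, j⟩ hij hne
      rw [Finset.HasAntidiagonal.mem_antidiagonal] at hij
      simp only at hij
      simp only
      have hi : i ≠ 0 := by
        rintro rfl
        apply hne
        simp_all
      by_cases him : m < i
      · rw [Polynomial.coeff_coe,
          Polynomial.coeff_eq_zero_of_natDegree_lt (by omega : A.natDegree < i), zero_mul]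
      · rw [ih j (by omega) (by omega), mul_zero]
    · intro h; simp at h

theorem exists_quot {S : Type*} [CommRing S] (E A : Polynomial S) (H : PowerSeries S)
    (hAH : (A : PowerSeries S) * H = 1) (hA0 : A.coeff 0 = 1) (N m : ℕ)
    (hE : E.natDegree ≤ N) (hA : A.natDegree ≤ m) (hm : m ≤ N)
    (h : ∀ r, N - m < r → r ≤ N → PowerSeries.coeff r ((E : PowerSeries S) * H) = 0) :
    ∃ g : Polynomial S, g.natDegree ≤ N - m ∧ E = A * g := by
  have h' := coeff_eq_zero_all E A H hAH hA0 N m hE hA hm h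
  have hg : ((PowerSeries.trunc (N - m + 1) ((E : PowerSeries S) * H) : Polynomial S) :
      PowerSeries S) = E * H := by
    ext r
    rw [Polynomial.coeff_coe, PowerSeries.coeff_trunc]
    split_ifs with hr
    · rfl
    · exact (h' r (by omega)).symm
  refine ⟨PowerSeries.trunc (N - m + 1) ((E : PowerSeries S) * H), ?_, ?_⟩
  · have := PowerSeries.natDegree_trunc_lt ((E : PowerSeries S) * H) (N - m)
    omega
  · apply Polynomial.coe_injective
    rw [Polynomial.coe_mul, hg, mul_left_comm, hAH, mul_one]

theorem revProd_coeff_zero {S : Type*} [CommRing S] [Algebra ℂ S] (l : List ℂ) :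
    (revProd S l).coeff 0 = 1 := by
  rw [Polynomial.coeff_zero_eq_eval_zero, revProd, Polynomial.eval_list_prod]
  apply List.prod_eq_one
  intro x hx
  simp at hx
  obtain ⟨a, _, rfl⟩ := hx
  rfl

/-- `∏_{j∈J} (1 + t_j z)` -/
def revJ {S : Type*} [CommRing S] {d : ℕ} (J : Finset (Fin d)) (t : Fin d → S) : Polynomial S :=
  ∏ j ∈ J, (1 + Polynomial.C (t j) * Polynomial.X)

theorem revJ_natDegree {S : Type*} [CommRing S] {d : ℕ} (J : Finset (Fin d)) (t : Fin d → S) :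
    (revJ J t).natDegree ≤ J.card := by
  refine (Polynomial.natDegree_prod_le _ _).trans ?_
  refine (Finset.sum_le_card_nsmul _ _ 1 fun j _ => natDegree_lin _).trans ?_
  simp

theorem reflect_revJ {S : Type*} [CommRing S] {d : ℕ} (J : Finset (Fin d)) (t : Fin d → S) :
    Polynomial.reflect J.card (revJ J t) = ∏ j ∈ J, (Polynomial.X + Polynomial.C (t j)) := by
  induction J using Finset.induction_on with
  | empty => simp [revJ]
  | insert j J hj ih =>
    have : revJ (insert j J) t = (1 + Polynomial.C (t j) * Polynomial.X) * revJ J t := by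
      simp [revJ, Finset.prod_insert hj]
    rw [this, Finset.card_insert_of_notMem hj, add_comm J.card 1,
      Polynomial.reflect_mul _ _ (natDegree_lin _) (revJ_natDegree J t), ih, reflect_lin,
      Finset.prod_insert hj]

theorem revJ_coeff {S : Type*} [CommRing S] {d : ℕ} (J : Finset (Fin d)) (t : Fin d → S)
    (r : ℕ) : (revJ J t).coeff r = ∑ s ∈ J.powersetCard r, ∏ j ∈ s, t j := by
  rw [revJ, Finset.prod_one_add, Polynomial.finsetSum_coeff]
  simp only [Finset.prod_mul_distrib, Finset.prod_const, ← map_prod, Polynomial.coeff_C_mul,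
    Polynomial.coeff_X_pow]
  rw [Finset.powersetCard_eq_filter, Finset.sum_filter]
  refine Finset.sum_congr rfl fun s _ => ?_
  by_cases h : s.card = r
  · simp [h]
  · simp [h, Ne.symm h]

theorem map_tanGen {S : Type*} [CommRing S] [Algebra ℂ S] (d ℓ : ℕ) (lam : ℕ → ℕ) (a : ℕ → ℂ)
    (n : ℕ) (J : Finset (Fin d)) (r : ℕ) (f : MvPolynomial (Fin d) ℂ →ₐ[ℂ] S) :
    PowerSeries.coeff r ((revJ J (fun j => f (X j)) : PowerSeries S) *
      hSer S (aTuple ℓ lam a n)) = f (tanGen d ℓ lam a n J r) := by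
  rw [mul_comm, PowerSeries.coeff_mul, Finset.Nat.sum_antidiagonal_eq_sum_range_succ_mk, tanGen,
    map_sum]
  refine Finset.sum_congr rfl fun k _ => ?_
  rw [Polynomial.coeff_coe, revJ_coeff, map_mul, hSer, PowerSeries.coeff_mk, elemSym]
  simp only [map_sum, map_prod]
  congr 1
  rw [← MvPolynomial.algebraMap_eq, AlgHom.commutes]

theorem aTuple_length (ℓ : ℕ) (lam : ℕ → ℕ) (a : ℕ → ℂ) (n : ℕ) :
    (aTuple ℓ lam a n).length = mRem ℓ lam n := by
  rw [aTuple, mRem, List.length_flatMap, Finset.sum_Ico_eq_sum_range, Finset.sum_range,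
    List.range_eq_range', List.drop_range', ← List.sum_ofFn]
  congr 1
  apply List.ext_getElem <;> simp

theorem mRem_le {d ℓ : ℕ} {lam : ℕ → ℕ} (hpart : IsPartitionOf d ℓ lam) (n : ℕ) (hn : n ≤ ℓ) :
    n + mRem ℓ lam n ≤ d := by
  obtain ⟨_, _, hpos, _, hsum⟩ := hpart
  rw [← hsum, mRem, Finset.range_eq_Ico, ← Finset.sum_Ico_consecutive _ (Nat.zero_le n) hn]
  have : ∑ i ∈ Finset.Ico 0 n, 1 ≤ ∑ i ∈ Finset.Ico 0 n, lam i :=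
    Finset.sum_le_sum fun i hi => hpos i (by simp at hi; omega)
  simp at this ⊢
  exact this

/-- columns of the boxes in rows `≥ n` -/
def cols (ℓ : ℕ) (lam : ℕ → ℕ) (n : ℕ) : List ℕ :=
  ((List.range ℓ).drop n).flatMap fun i => List.range (lam i)

theorem aTuple_eq (ℓ : ℕ) (lam : ℕ → ℕ) (a : ℕ → ℂ) (n : ℕ) :
    aTuple ℓ lam a n = (cols ℓ lam n).map a := by
  rw [aTuple, cols, List.map_flatMap]

theorem count_flatMap_le (lam : ℕ → ℕ) (j : ℕ) (L : List ℕ) :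
    (L.flatMap fun i => List.range (lam i)).count j ≤ L.length := by
  induction L with
  | nil => simp
  | cons x L ih =>
    have := List.nodup_iff_count_le_one.1 (List.nodup_range (n := lam x)) j
    simp only [List.flatMap_cons, List.count_append, List.length_cons]
    omega

theorem count_flatMap_eq (lam : ℕ → ℕ) (j : ℕ) (L : List ℕ) (hL : ∀ i ∈ L, j < lam i) :
    (L.flatMap fun i => List.range (lam i)).count j = L.length := by
  induction L with
  | nil => simp
  | cons x L ih =>
    have := List.count_eq_one_of_mem (List.nodup_range (n := lam x))
      (List.mem_range.2 (hL x (by simp)))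
    have := ih fun i hi => hL i (by simp [hi])
    simp only [List.flatMap_cons, List.count_append, List.length_cons]
    omega

theorem cols_count {d ℓ : ℕ} {lam : ℕ → ℕ} (hpart : IsPartitionOf d ℓ lam) (n : ℕ) (hn : n < ℓ)
    (j : ℕ) : (cols ℓ lam n).count j = 0 ∨
      (cols ℓ lam n).count j + n = (cols ℓ lam 0).count j := by
  by_cases h : j ∈ cols ℓ lam n
  · right
    have h0 : cols ℓ lam 0 = (((List.range ℓ).take n).flatMap fun i => List.range (lam i)) ++
        cols ℓ lam n := by
      rw [cols, cols, ← List.flatMap_append, List.take_append_drop, List.drop_zero]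
    rw [h0, List.count_append, count_flatMap_eq]
    · simp; omega
    · intro i hi
      rw [cols, List.mem_flatMap] at h
      obtain ⟨k, hk, hjk⟩ := h
      rw [List.mem_range] at hjk
      refine hjk.trans_le (hpart.2.1 i k ?_)
      rw [List.range_eq_range', List.drop_range', List.mem_range'_1] at hk
      rw [List.take_range, List.mem_range] at hi
      omega
  · left
    exact List.count_eq_zero.2 h

theorem cols_le {d ℓ : ℕ} {lam : ℕ → ℕ} (hpart : IsPartitionOf d ℓ lam)
    (b : Fin d → ℕ) (hb : (Finset.univ : Finset (Fin d)).val.map b = (cols ℓ lam 0 : Multiset ℕ))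
    (n : ℕ) (hn : n < ℓ) (J : Finset (Fin d)) (hJ : J.card = d - n) :
    (cols ℓ lam n : Multiset ℕ) ≤ J.val.map b := by
  rw [Multiset.le_iff_count]
  intro j
  have hd := mRem_le hpart n hn.le
  have h1 : (Finset.univ : Finset (Fin d)).val.map b = J.val.map b + Jᶜ.val.map b := by
    rw [← Multiset.map_add, ← Finset.disjUnion_val (s := J) (t := Jᶜ) disjoint_compl_right]
    simp
  rw [hb] at h1
  have h2 := congrArg (Multiset.count j) h1
  rw [Multiset.count_add, Multiset.coe_count] at h2
  have h3 := Multiset.count_le_card j (Jᶜ.val.map b)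
  rw [Multiset.card_map, Finset.card_val, Finset.card_compl, Fintype.card_fin] at h3
  rw [Multiset.coe_count]
  rcases cols_count hpart n hn j with h | h <;> omega

theorem exists_b {d ℓ : ℕ} {lam : ℕ → ℕ} (hpart : IsPartitionOf d ℓ lam) :
    ∃ b : Fin d → ℕ,
      (Finset.univ : Finset (Fin d)).val.map b = (cols ℓ lam 0 : Multiset ℕ) := by
  have hl : (cols ℓ lam 0).length = d := by
    have := aTuple_length ℓ lam (fun _ => 0) 0
    rw [aTuple_eq, List.length_map] at this
    rw [this, mRem, ← Finset.range_eq_Ico]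
    exact hpart.2.2.2.2
  subst hl
  refine ⟨(cols ℓ lam 0).get, ?_⟩
  rw [Fin.univ_val_map, List.ofFn_get]

theorem TGP_nontrivial {d ℓ : ℕ} {lam : ℕ → ℕ} (hpart : IsPartitionOf d ℓ lam) (a : ℕ → ℂ) :
    Nontrivial (TGPAlg d ℓ lam a) := by
  obtain ⟨b, hb⟩ := exists_b hpart
  let f : MvPolynomial (Fin d) ℂ →ₐ[ℂ] ℂ := MvPolynomial.aeval (fun j => a (b j))
  have hle : tanIdeal d ℓ lam a ≤ RingHom.ker f := by
    rw [tanIdeal, Ideal.span_le]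
    rintro g ⟨n, J, r, hn, hJ, hr, hrN, rfl⟩
    change f _ = 0
    rw [← map_tanGen]
    obtain ⟨u, hu⟩ := Multiset.le_iff_exists_add.1 (cols_le hpart b hb n hn J hJ)
    let lin : ℕ → Polynomial ℂ := fun c => 1 + Polynomial.C (a c) * Polynomial.X
    have hcard : Multiset.card u = d - n - mRem ℓ lam n := by
      have := congrArg Multiset.card hu
      rw [Multiset.card_map, Finset.card_val, hJ, Multiset.card_add, Multiset.coe_card] at this
      have h2 := aTuple_length ℓ lam a n
      rw [aTuple_eq, List.length_map] at h2
      omega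
    have hE : revJ J (fun j => f (X j)) = revProd ℂ (aTuple ℓ lam a n) * (u.map lin).prod := by
      have h1 : revJ J (fun j => f (X j)) = ((J.val.map b).map lin).prod := by
        rw [Multiset.map_map, revJ]
        simp [f, lin]
      rw [h1, hu, Multiset.map_add, Multiset.prod_add, revProd, aTuple_eq]
      simp [lin, Function.comp_def]
    rw [hE, Polynomial.coe_mul, mul_right_comm, revProd_mul_hSer, one_mul, Polynomial.coeff_coe]
    apply Polynomial.coeff_eq_zero_of_natDegree_lt
    refine lt_of_le_of_lt (Polynomial.natDegree_multiset_prod_le _) (lt_of_le_of_lt ?_ hr)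
    rw [← hcard, Multiset.map_map]
    refine (Multiset.sum_le_card_nsmul _ 1 ?_).trans ?_
    · intro x hx
      rw [Multiset.mem_map] at hx
      obtain ⟨c, _, rfl⟩ := hx
      exact natDegree_lin _
    · simp
  apply Ideal.Quotient.nontrivial_iff.2
  intro htop
  have : (1 : MvPolynomial (Fin d) ℂ) ∈ RingHom.ker f := hle (htop ▸ Submodule.mem_top)
  rw [RingHom.mem_ker, map_one] at this
  exact one_ne_zero this

theorem monic_prod_list {S : Type*} [CommRing S] [Nontrivial S] [Algebra ℂ S] (l : List ℂ) :
    (l.map fun c => Polynomial.X + Polynomial.C (algebraMap ℂ S c)).prod.Monic ∧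
    (l.map fun c => Polynomial.X + Polynomial.C (algebraMap ℂ S c)).prod.natDegree =
      l.length := by
  induction l with
  | nil => simp
  | cons x l ih =>
    have hx := Polynomial.monic_X_add_C (algebraMap ℂ S x)
    rw [List.map_cons, List.prod_cons]
    refine ⟨hx.mul ih.1, ?_⟩
    rw [hx.natDegree_mul ih.1, ih.2, Polynomial.natDegree_X_add_C, List.length_cons, add_comm]

/-- in `R_a(λ)[X]`, for each `0 ≤ n < ℓ` and each `J` with `|J| = d − n`,
the image of `∏_{j∈J}(X + t_j)` is `(∏_{i}(X + a^{(n)}_i)) · Q` for a monic `Q` of degree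
`d − n − m_λ(n)`. -/
theorem deformed_TGP_divisibility (d ℓ : ℕ) (lam : ℕ → ℕ) (hpart : IsPartitionOf d ℓ lam)
    (a : ℕ → ℂ) (n : ℕ) (hn : n < ℓ) (J : Finset (Fin d)) (hJ : J.card = d - n) :
    ∃ Q : Polynomial (TGPAlg d ℓ lam a), Q.Monic ∧ Q.natDegree = d - n - mRem ℓ lam n ∧
      Polynomial.map (Ideal.Quotient.mk (tanIdeal d ℓ lam a))
          (∏ j ∈ J, (Polynomial.X + Polynomial.C (X j))) =
        ((aTuple ℓ lam a n).map fun c =>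
            Polynomial.X + Polynomial.C (algebraMap ℂ (TGPAlg d ℓ lam a) c)).prod * Q := by
  have := TGP_nontrivial hpart a
  have hd := mRem_le hpart n hn.le
  let f : MvPolynomial (Fin d) ℂ →ₐ[ℂ] TGPAlg d ℓ lam a := Ideal.Quotient.mkₐ ℂ _
  have hlen := aTuple_length ℓ lam a n
  obtain ⟨g, hg, hEg⟩ := exists_quot (revJ J (fun j => f (X j)))
    (revProd (TGPAlg d ℓ lam a) (aTuple ℓ lam a n)) (hSer _ (aTuple ℓ lam a n))
    (revProd_mul_hSer _) (revProd_coeff_zero _) (d - n) (mRem ℓ lam n)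
    ((revJ_natDegree _ _).trans hJ.le) ((revProd_natDegree _).trans hlen.le) (by omega) (by
      intro r hr hrN
      rw [map_tanGen]
      exact Ideal.Quotient.eq_zero_iff_mem.2
        (Ideal.subset_span ⟨n, J, r, hn, hJ, hr, hrN, rfl⟩))
  have hP : Polynomial.map (Ideal.Quotient.mk (tanIdeal d ℓ lam a))
      (∏ j ∈ J, (Polynomial.X + Polynomial.C (X j))) =
      ∏ j ∈ J, (Polynomial.X + Polynomial.C (f (X j))) := by
    simp [Polynomial.map_prod, f]
  have hfac : ∏ j ∈ J, (Polynomial.X + Polynomial.C (f (X j))) =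
      ((aTuple ℓ lam a n).map fun c =>
        Polynomial.X + Polynomial.C (algebraMap ℂ (TGPAlg d ℓ lam a) c)).prod *
        Polynomial.reflect (d - n - mRem ℓ lam n) g := by
    rw [← reflect_revJ, hEg, ← reflect_revProd, hJ, hlen,
      ← Polynomial.reflect_mul _ _ ((revProd_natDegree _).trans hlen.le) hg]
    congr 1
    omega
  have hPm : (∏ j ∈ J, (Polynomial.X + Polynomial.C (f (X j)))).Monic :=
    Polynomial.monic_prod_of_monic _ _ fun j _ => Polynomial.monic_X_add_C _
  have hPd : (∏ j ∈ J, (Polynomial.X + Polynomial.C (f (X j)))).natDegree = d - n := by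
    rw [Polynomial.natDegree_prod_of_monic _ _ fun j _ => Polynomial.monic_X_add_C _]
    simp [hJ]
  obtain ⟨hB, hBd⟩ := monic_prod_list (S := TGPAlg d ℓ lam a) (aTuple ℓ lam a n)
  rw [hlen] at hBd
  have hQ := hB.of_mul_monic_left (hfac ▸ hPm)
  refine ⟨_, hQ, ?_, hP.trans hfac⟩
  have := hB.natDegree_mul hQ
  rw [← hfac, hPd, hBd] at this
  omega

end
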